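/- The Fock representation is irreducible: if W is a closed subspace of ℓ²(ℕ, ℂ) with T(W) ⊆ W and T*(W) ⊆ W, then W = {0} or W = ℓ²(ℕ, ℂ), where T is the Fock operator and T* its adjoint. -/

import Mathlib

noncomputable section

/-- ℓ²(ℕ, ℂ), the Hilbert space of square-summable complex sequences. -/
abbrev ellTwo : Type := lp (fun _ : ℕ => ℂ) 2

/-- The standard orthonormal basis vectors of ℓ²(ℕ, ℂ). -/
def e (n : ℕ) : ellTwo := lp.single 2 n 1

lemma inner_e_left (n : ℕ) (x : ellTwo) : inner ℂ (e n) x = x n := by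
  simp [e, lp.inner_single_left]

lemma e_apply (n k : ℕ) : e n k = if k = n then 1 else 0 := by
  simp [e, lp.single_apply, Pi.single_apply]

/-- A subspace orthogonal to every basis vector is trivial. -/
lemma eq_bot_of_e_mem_orthogonal {W : Submodule ℂ ellTwo} (h : ∀ n, e n ∈ Wᗮ) : W = ⊥ := by
  refine (Submodule.eq_bot_iff W).2 fun x hx => ?_
  ext n
  rw [← inner_e_left n x]
  exact Submodule.inner_left_of_mem_orthogonal hx (h n)

/-- A subspace invariant under a weighted shift with nonzero weights contains all basis vectors
as soon as it contains the first one. -/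
lemma e_mem_of_e_zero_mem {T : ellTwo →L[ℂ] ellTwo} {c : ℕ → ℂ} (hc : ∀ n, c n ≠ 0)
    (hT : ∀ n, T (e n) = c n • e (n + 1)) {W : Submodule ℂ ellTwo} (hW : ∀ x ∈ W, T x ∈ W)
    (h0 : e 0 ∈ W) (n : ℕ) : e n ∈ W := by
  induction n with
  | zero => exact h0
  | succ n ih =>
    have h := hW _ ih
    rw [hT] at h
    exact (W.smul_mem_iff (hc n)).1 h

/-- The kernel of the adjoint of a weighted shift with nonzero weights is spanned by the first
basis vector. -/
lemma eq_smul_e_zero_of_adjoint_eq_zero {T : ellTwo →L[ℂ] ellTwo} {c : ℕ → ℂ}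
    (hc : ∀ n, c n ≠ 0) (hT : ∀ n, T (e n) = c n • e (n + 1)) {x : ellTwo}
    (hx : ContinuousLinearMap.adjoint T x = 0) : x = x 0 • e 0 := by
  ext n
  cases n with
  | zero => simp [e_apply]
  | succ n =>
    have h := ContinuousLinearMap.adjoint_inner_right T (e n) x
    rw [hx, hT, inner_zero_right, inner_smul_left, inner_e_left] at h
    have h' : x (n + 1) = 0 := by simpa [hc n] using h.symm
    simp [e_apply, h']

lemma adjoint_e_zero {T : ellTwo →L[ℂ] ellTwo} {c : ℕ → ℂ}
    (hT : ∀ n, T (e n) = c n • e (n + 1)) : ContinuousLinearMap.adjoint T (e 0) = 0 := by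
  ext n
  rw [← inner_e_left, ContinuousLinearMap.adjoint_inner_right, hT, inner_smul_left, inner_e_left]
  simp [e_apply]

/-- A weighted shift with nonzero weights has no nontrivial closed reducing subspace. -/
lemma eq_bot_or_eq_top_of_reducing {T : ellTwo →L[ℂ] ellTwo} {c : ℕ → ℂ} (hc : ∀ n, c n ≠ 0)
    (hT : ∀ n, T (e n) = c n • e (n + 1)) {W : Submodule ℂ ellTwo}
    (hWclosed : IsClosed (W : Set ellTwo)) (hWT : ∀ x ∈ W, T x ∈ W)
    (hWTadj : ∀ x ∈ W, ContinuousLinearMap.adjoint T x ∈ W) : W = ⊥ ∨ W = ⊤ := by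
  have : CompleteSpace W := hWclosed.completeSpace_coe
  have hperpT : ∀ x ∈ Wᗮ, T x ∈ Wᗮ := fun x hx y hy => by
    rw [← ContinuousLinearMap.adjoint_inner_left]
    exact hx _ (hWTadj y hy)
  have hperpAdj : ∀ x ∈ Wᗮ, ContinuousLinearMap.adjoint T x ∈ Wᗮ := fun x hx y hy => by
    rw [ContinuousLinearMap.adjoint_inner_right]
    exact hx _ (hWT y hy)
  obtain ⟨w, hw, v, hv, hwv⟩ := W.exists_add_mem_mem_orthogonal (e 0)
  have hsum : ContinuousLinearMap.adjoint T w + ContinuousLinearMap.adjoint T v = 0 := by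
    rw [← map_add, ← hwv, adjoint_e_zero hT]
  have hw_ker : ContinuousLinearMap.adjoint T w = 0 := by
    refine (Submodule.disjoint_def.1 W.orthogonal_disjoint) _ (hWTadj w hw) ?_
    rw [eq_neg_of_add_eq_zero_left hsum]
    exact neg_mem (hperpAdj v hv)
  have hw_smul := eq_smul_e_zero_of_adjoint_eq_zero hc hT hw_ker
  by_cases h0 : w 0 = 0
  · left
    rw [h0, zero_smul] at hw_smul
    rw [hw_smul, zero_add] at hwv
    exact eq_bot_of_e_mem_orthogonal (e_mem_of_e_zero_mem hc hT hperpT (hwv ▸ hv))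
  · right
    have he : e 0 ∈ W := (W.smul_mem_iff h0).1 (hw_smul ▸ hw)
    refine W.orthogonal_eq_bot_iff.1 (eq_bot_of_e_mem_orthogonal fun n => ?_)
    exact W.le_orthogonal_orthogonal (e_mem_of_e_zero_mem hc hT hWT he n)

/-- The Fock representation is irreducible: any closed subspace invariant under both the
Fock operator `T` and its adjoint is `{0}` or the whole space. -/
theorem stmt_4 (q : ℝ) (hq0 : 0 < q) (hq1 : q < 1)
    (T : ellTwo →L[ℂ] ellTwo)
    (hT : ∀ n : ℕ, T (e n) = (Real.sqrt (1 - q ^ (2 * (n + 1))) : ℂ) • e (n + 1))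
    (W : Submodule ℂ ellTwo) (hWclosed : IsClosed (W : Set ellTwo))
    (hWT : ∀ x ∈ W, T x ∈ W)
    (hWTadj : ∀ x ∈ W, ContinuousLinearMap.adjoint T x ∈ W) :
    W = ⊥ ∨ W = ⊤ := by
  refine eq_bot_or_eq_top_of_reducing (fun n => ?_) hT hWclosed hWT hWTadj
  have hlt : q ^ (2 * (n + 1)) < 1 := pow_lt_one₀ hq0.le hq1 (by positivity)
  exact Complex.ofReal_ne_zero.2 (Real.sqrt_pos.2 (sub_pos.2 hlt)).ne'
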